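/- Let k be an algebraically closed field and let a, b, c, d, e, B, C, E ∈ k satisfy the six equations: E·(1 - B - E) = 0; E·(-d - B + d·E) = 0; B·(1 - d - B) - a·(1 - E²) = 0; E·(C + C·E + e - e·E) = 0; C·(1 - d - 2B - B·E) - b·(1 - E²) - e·B = 0; and (1 + E)·(-c·(1 - E) - C²) - e·C = 0. Suppose moreover that f_n ≠ 0 for all n ≥ 1, where f_n ∈ k is computed from the pair (a,d). Then the family (i,j,l) ↦ y^i·x^j·z^l (for i, j, l ≥ 0) is a k-vector-space basis of T = T(a,b,c,d,e,1; 0,B,C,0,E,0). -/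

import Mathlib

noncomputable section

open FreeAlgebra

/-- The generator `x` of the free algebra `k⟨x,y,z⟩`. -/
def Xf (k : Type*) [Field k] : FreeAlgebra k (Fin 3) := FreeAlgebra.ι k 0

/-- The generator `y` of the free algebra `k⟨x,y,z⟩`. -/
def Yf (k : Type*) [Field k] : FreeAlgebra k (Fin 3) := FreeAlgebra.ι k 1

/-- The generator `z` of the free algebra `k⟨x,y,z⟩`. -/
def Zf (k : Type*) [Field k] : FreeAlgebra k (Fin 3) := FreeAlgebra.ι k 2

/-- The relations defining `T(a,b,c,d,e,f; A,B,C,D,E,F)`: `xy = yx`,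
`zx = a·x² + b·xy + c·y² + d·xz + e·yz + f·z²`, and
`zy = A·x² + B·xy + C·y² + D·xz + E·yz + F·z²`. -/
def Trel (k : Type*) [Field k] (a b c d e f A B C D E F : k) :
    FreeAlgebra k (Fin 3) → FreeAlgebra k (Fin 3) → Prop := fun m n =>
  (m = Xf k * Yf k ∧ n = Yf k * Xf k) ∨
  (m = Zf k * Xf k ∧
    n = a • (Xf k) ^ 2 + b • (Xf k * Yf k) + c • (Yf k) ^ 2 +
        d • (Xf k * Zf k) + e • (Yf k * Zf k) + f • (Zf k) ^ 2) ∨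
  (m = Zf k * Yf k ∧
    n = A • (Xf k) ^ 2 + B • (Xf k * Yf k) + C • (Yf k) ^ 2 +
        D • (Xf k * Zf k) + E • (Yf k * Zf k) + F • (Zf k) ^ 2)

/-- The algebra `T(a,b,c,d,e,f; A,B,C,D,E,F)`. -/
abbrev Talg (k : Type*) [Field k] (a b c d e f A B C D E F : k) :=
  RingQuot (Trel k a b c d e f A B C D E F)

/-- The image of `x` in `T`. -/
def Tx (k : Type*) [Field k] (a b c d e f A B C D E F : k) :
    Talg k a b c d e f A B C D E F :=
  RingQuot.mkAlgHom k (Trel k a b c d e f A B C D E F) (Xf k)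

/-- The image of `y` in `T`. -/
def Ty (k : Type*) [Field k] (a b c d e f A B C D E F : k) :
    Talg k a b c d e f A B C D E F :=
  RingQuot.mkAlgHom k (Trel k a b c d e f A B C D E F) (Yf k)

/-- The image of `z` in `T`. -/
def Tz (k : Type*) [Field k] (a b c d e f A B C D E F : k) :
    Talg k a b c d e f A B C D E F :=
  RingQuot.mkAlgHom k (Trel k a b c d e f A B C D E F) (Zf k)

/-- The property that the family `(i,j,l) ↦ y^i x^j z^l` is a `k`-vector-space basis of `T`;
following the paper, this is exactly the condition that `T` is a graded twisted tensor
product of `k[x,y]` and `k[z]`. -/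
def ThasBasis (k : Type*) [Field k] (a b c d e f A B C D E F : k) : Prop :=
  LinearIndependent k
      (fun p : ℕ × ℕ × ℕ =>
        (Ty k a b c d e f A B C D E F) ^ p.1 * (Tx k a b c d e f A B C D E F) ^ p.2.1 *
          (Tz k a b c d e f A B C D E F) ^ p.2.2) ∧
    Submodule.span k
      (Set.range fun p : ℕ × ℕ × ℕ =>
        (Ty k a b c d e f A B C D E F) ^ p.1 * (Tx k a b c d e f A B C D E F) ^ p.2.1 *
          (Tz k a b c d e f A B C D E F) ^ p.2.2) = ⊤

/-- The pair of sequences `(e_n, f_n)` associated to parameters `a, d`. -/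
def efPair {k : Type*} [Field k] (a d : k) : ℕ → k × k
  | 0 => (1, 1)
  | n + 1 => (d * (efPair a d n).1 + (efPair a d n).2,
              -a * (efPair a d n).1 + (efPair a d n).2)

/-- The sequence `f_n(a,d)`. -/
def fSeq {k : Type*} [Field k] (a d : k) (n : ℕ) : k := (efPair a d n).2

/-- The coefficient of `x^(n+1)` in the normal form of `z * x^n`. -/
def leadCoeff {k : Type*} [Field k] (a d : k) : ℕ → k
  | 0 => 0
  | n + 1 => (a + d * leadCoeff a d n) / (1 - leadCoeff a d n)

lemma fSeq_ne_zero {k : Type*} [Field k] {a d : k}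
    (hf : ∀ n : ℕ, 1 ≤ n → fSeq a d n ≠ 0) (n : ℕ) : fSeq a d n ≠ 0 := by
  rcases n with _ | n
  · simp [fSeq, efPair]
  · exact hf _ (by omega)

lemma leadCoeff_succ_eq {k : Type*} [Field k] {a d : k}
    (hf : ∀ n : ℕ, 1 ≤ n → fSeq a d n ≠ 0) (n : ℕ) :
    leadCoeff a d (n + 1) = a * (efPair a d n).1 / fSeq a d n := by
  induction n with
  | zero => simp [leadCoeff, fSeq, efPair]
  | succ n ih =>
    have h0 := fSeq_ne_zero hf n
    have h1 := fSeq_ne_zero hf (n + 1)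
    have hs : fSeq a d (n + 1) = -a * (efPair a d n).1 + fSeq a d n := rfl
    have he : (efPair a d (n + 1)).1 = d * (efPair a d n).1 + fSeq a d n := rfl
    have h2 : 1 - leadCoeff a d (n + 1) = fSeq a d (n + 1) / fSeq a d n := by
      rw [ih, hs]
      field_simp
      ring
    rw [leadCoeff, h2, ih, he]
    field_simp
    ring

lemma one_sub_leadCoeff_ne_zero {k : Type*} [Field k] {a d : k}
    (hf : ∀ n : ℕ, 1 ≤ n → fSeq a d n ≠ 0) (n : ℕ) : 1 - leadCoeff a d n ≠ 0 := by
  rcases n with _ | n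
  · simp [leadCoeff]
  · have h0 := fSeq_ne_zero hf n
    have h1 := fSeq_ne_zero hf (n + 1)
    have hs : fSeq a d (n + 1) = -a * (efPair a d n).1 + fSeq a d n := rfl
    have h2 : 1 - leadCoeff a d (n + 1) = fSeq a d (n + 1) / fSeq a d n := by
      rw [leadCoeff_succ_eq hf, hs]
      field_simp
      ring
    rw [h2]
    exact div_ne_zero h1 h0

lemma leadCoeff_succ_mul {k : Type*} [Field k] {a d : k}
    (hf : ∀ n : ℕ, 1 ≤ n → fSeq a d n ≠ 0) (n : ℕ) :
    leadCoeff a d (n + 1) * (1 - leadCoeff a d n) = a + d * leadCoeff a d n :=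
  div_mul_cancel₀ _ (one_sub_leadCoeff_ne_zero hf n)

section Spanning

variable {k : Type*} [Field k] {T : Type*} [Ring T] [Algebra k T]

/-- The span of the monomials `y^i * x^j * z^l` with `j ≤ n`. -/
def xFiltration (k : Type*) [Field k] {T : Type*} [Ring T] [Algebra k T] (x y z : T) (n : ℕ) :
    Submodule k T :=
  Submodule.span k {t | ∃ i j l : ℕ, j ≤ n ∧ t = y ^ i * x ^ j * z ^ l}

lemma mem_xFiltration {x y z : T} {n i j l : ℕ} (h : j ≤ n) :
    y ^ i * x ^ j * z ^ l ∈ xFiltration k x y z n :=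
  Submodule.subset_span ⟨i, j, l, h, rfl⟩

lemma xFiltration_mono {x y z : T} {m n : ℕ} (h : m ≤ n) :
    xFiltration k x y z m ≤ xFiltration k x y z n := by
  refine Submodule.span_mono ?_
  rintro t ⟨i, j, l, hj, rfl⟩
  exact ⟨i, j, l, hj.trans h, rfl⟩

lemma map_mem_xFiltration {x y z : T} {n m : ℕ} (f : T →ₗ[k] T)
    (h : ∀ i j l : ℕ, j ≤ n → f (y ^ i * x ^ j * z ^ l) ∈ xFiltration k x y z m)
    {t : T} (ht : t ∈ xFiltration k x y z n) : f t ∈ xFiltration k x y z m := by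
  have : xFiltration k x y z n ≤ (xFiltration k x y z m).comap f := by
    refine Submodule.span_le.2 ?_
    rintro t ⟨i, j, l, hj, rfl⟩
    exact h i j l hj
  exact this ht

lemma y_mul_mem_xFiltration {x y z : T} {n : ℕ} {t : T} (ht : t ∈ xFiltration k x y z n) :
    y * t ∈ xFiltration k x y z n := by
  refine map_mem_xFiltration (LinearMap.mulLeft k y) (fun i j l hj => ?_) ht
  have : LinearMap.mulLeft k y (y ^ i * x ^ j * z ^ l) = y ^ (i + 1) * x ^ j * z ^ l := by
    simp [pow_succ', mul_assoc]
  rw [this]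
  exact mem_xFiltration hj

lemma x_mul_mem_xFiltration {x y z : T} (hxy : x * y = y * x) {n : ℕ} {t : T}
    (ht : t ∈ xFiltration k x y z n) : x * t ∈ xFiltration k x y z (n + 1) := by
  refine map_mem_xFiltration (LinearMap.mulLeft k x) (fun i j l hj => ?_) ht
  have hc : x * y ^ i = y ^ i * x := (show Commute x y from hxy).pow_right i
  have : LinearMap.mulLeft k x (y ^ i * x ^ j * z ^ l) = y ^ i * x ^ (j + 1) * z ^ l := by
    simp only [LinearMap.mulLeft_apply, pow_succ', ← mul_assoc, hc]
  rw [this]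
  exact mem_xFiltration (by omega)

lemma mul_z_pow_mem_xFiltration {x y z : T} {n : ℕ} (m : ℕ) {t : T}
    (ht : t ∈ xFiltration k x y z n) : t * z ^ m ∈ xFiltration k x y z n := by
  refine map_mem_xFiltration (LinearMap.mulRight k (z ^ m)) (fun i j l hj => ?_) ht
  have : LinearMap.mulRight k (z ^ m) (y ^ i * x ^ j * z ^ l) = y ^ i * x ^ j * z ^ (l + m) := by
    simp [pow_add, mul_assoc]
  rw [this]
  exact mem_xFiltration hj

lemma z_mul_mem_xFiltration_of {x y z : T} {B C E : k} (hxy : x * y = y * x)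
    (hzy : z * y = B • (x * y) + C • y ^ 2 + E • (y * z)) {n : ℕ}
    (hn : ∀ j ≤ n, z * x ^ j ∈ xFiltration k x y z (n + 1)) {t : T}
    (ht : t ∈ xFiltration k x y z n) : z * t ∈ xFiltration k x y z (n + 1) := by
  refine map_mem_xFiltration (LinearMap.mulLeft k z) (fun i j l hj => ?_) ht
  rw [LinearMap.mulLeft_apply]
  induction i with
  | zero =>
    rw [pow_zero, one_mul, ← mul_assoc]
    exact mul_z_pow_mem_xFiltration l (hn j hj)
  | succ i ih =>
    set s := y ^ i * x ^ j * z ^ l with hs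
    have hsm : s ∈ xFiltration k x y z n := mem_xFiltration hj
    have : z * (y ^ (i + 1) * x ^ j * z ^ l)
        = y * (B • (x * s) + C • (y * s) + E • (z * s)) := by
      calc z * (y ^ (i + 1) * x ^ j * z ^ l) = (z * y) * s := by
            simp only [hs, pow_succ', mul_assoc]
        _ = _ := by
            rw [hzy, hxy]
            simp only [pow_two, add_mul, mul_add, smul_mul_assoc, mul_smul_comm, mul_assoc]
    rw [this]
    refine y_mul_mem_xFiltration (add_mem (add_mem ?_ ?_) ?_) <;> refine Submodule.smul_mem _ _ ?_
    · exact x_mul_mem_xFiltration hxy hsm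
    · exact xFiltration_mono (Nat.le_succ n) (y_mul_mem_xFiltration hsm)
    · exact ih

lemma z_mul_x_pow_sub_mem_xFiltration {x y z : T} {a b c d e B C E : k} (hxy : x * y = y * x)
    (hzx : z * x = a • x ^ 2 + b • (x * y) + c • y ^ 2 + d • (x * z) + e • (y * z) + z ^ 2)
    (hzy : z * y = B • (x * y) + C • y ^ 2 + E • (y * z))
    (hf : ∀ n : ℕ, 1 ≤ n → fSeq a d n ≠ 0) (n : ℕ) :
    z * x ^ n - leadCoeff a d n • x ^ (n + 1) ∈ xFiltration k x y z n := by
  induction n using Nat.strong_induction_on with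
  | _ n ih =>
  rcases n with _ | n
  · simpa [leadCoeff] using (mem_xFiltration le_rfl : y ^ 0 * x ^ 0 * z ^ 1 ∈ xFiltration k x y z 0)
  have hx : ∀ m, x ^ m ∈ xFiltration k x y z m := fun m => by
    simpa using (mem_xFiltration le_rfl : y ^ 0 * x ^ m * z ^ 0 ∈ xFiltration k x y z m)
  have hz : ∀ j ≤ n, z * x ^ j ∈ xFiltration k x y z (n + 1) := fun j hj => by
    have h := add_mem (xFiltration_mono (show j ≤ n + 1 by omega) (ih j (by omega)))
      (Submodule.smul_mem _ (leadCoeff a d j)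
        (xFiltration_mono (show j + 1 ≤ n + 1 by omega) (hx (j + 1))))
    simpa using h
  set α := leadCoeff a d n with hα
  set β := leadCoeff a d (n + 1) with hβ
  have hαβ : β * (1 - α) = a + d * α := leadCoeff_succ_mul hf n
  have hne : 1 - α ≠ 0 := one_sub_leadCoeff_ne_zero hf n
  obtain ⟨w, hw, hwn⟩ : ∃ w, w ∈ xFiltration k x y z n ∧ z * x ^ n = α • x ^ (n + 1) + w :=
    ⟨_, ih n (by omega), (add_sub_cancel _ _).symm⟩
  have key : (1 - α) • (z * x ^ (n + 1) - β • x ^ (n + 1 + 1))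
      = b • (y * x ^ (n + 1)) + c • (y * (y * x ^ n)) + d • (x * w) + e • (y * (z * x ^ n))
        + z * w := by
    have e1 : z * x ^ (n + 1) = a • x ^ (n + 2) + b • (y * x ^ (n + 1)) + c • (y * (y * x ^ n))
        + d • (x * (z * x ^ n)) + e • (y * (z * x ^ n)) + z * (z * x ^ n) := by
      calc z * x ^ (n + 1) = (z * x) * x ^ n := by rw [pow_succ', mul_assoc]
        _ = _ := by
          rw [hzx, hxy]
          simp only [add_mul, smul_mul_assoc, pow_succ', pow_zero, mul_one, mul_assoc]
    have e2 : z * (z * x ^ n) = α • (z * x ^ (n + 1)) + z * w := by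
      rw [hwn, mul_add, mul_smul_comm]
    have e3 : x * (z * x ^ n) = α • x ^ (n + 2) + x * w := by
      rw [hwn, mul_add, mul_smul_comm, ← pow_succ']
    rw [e2, e3] at e1
    rw [smul_sub, smul_smul, mul_comm (1 - α) β, hαβ, sub_smul, one_smul]
    nth_rewrite 1 [e1]
    module
  rw [← inv_smul_smul₀ hne (z * x ^ (n + 1) - β • x ^ (n + 1 + 1)), key]
  refine Submodule.smul_mem _ _ (add_mem (add_mem (add_mem (add_mem ?_ ?_) ?_) ?_) ?_)
  · exact Submodule.smul_mem _ _ (y_mul_mem_xFiltration (hx _))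
  · exact Submodule.smul_mem _ _ (xFiltration_mono (Nat.le_succ n)
      (y_mul_mem_xFiltration (y_mul_mem_xFiltration (hx _))))
  · exact Submodule.smul_mem _ _ (x_mul_mem_xFiltration hxy hw)
  · exact Submodule.smul_mem _ _ (y_mul_mem_xFiltration (hz n le_rfl))
  · exact z_mul_mem_xFiltration_of hxy hzy hz hw

lemma z_mul_mem_xFiltration {x y z : T} {a b c d e B C E : k} (hxy : x * y = y * x)
    (hzx : z * x = a • x ^ 2 + b • (x * y) + c • y ^ 2 + d • (x * z) + e • (y * z) + z ^ 2)
    (hzy : z * y = B • (x * y) + C • y ^ 2 + E • (y * z))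
    (hf : ∀ n : ℕ, 1 ≤ n → fSeq a d n ≠ 0) {n : ℕ} {t : T}
    (ht : t ∈ xFiltration k x y z n) : z * t ∈ xFiltration k x y z (n + 1) := by
  refine z_mul_mem_xFiltration_of hxy hzy (fun j hj => ?_) ht
  have hx : x ^ (j + 1) ∈ xFiltration k x y z (j + 1) := by
    simpa using
      (mem_xFiltration le_rfl : y ^ 0 * x ^ (j + 1) * z ^ 0 ∈ xFiltration k x y z (j + 1))
  have h := add_mem
    (xFiltration_mono (Nat.le_succ j) (z_mul_x_pow_sub_mem_xFiltration hxy hzx hzy hf j))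
    (Submodule.smul_mem _ (leadCoeff a d j) hx)
  rw [sub_add_cancel] at h
  exact xFiltration_mono (by omega) h

lemma span_monomials_eq_top_of_surjective {x y z : T} {a b c d e B C E : k}
    {π : FreeAlgebra k (Fin 3) →ₐ[k] T} (hπ : Function.Surjective π)
    (hx : π (Xf k) = x) (hy : π (Yf k) = y) (hz : π (Zf k) = z) (hxy : x * y = y * x)
    (hzx : z * x = a • x ^ 2 + b • (x * y) + c • y ^ 2 + d • (x * z) + e • (y * z) + z ^ 2)
    (hzy : z * y = B • (x * y) + C • y ^ 2 + E • (y * z))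
    (hf : ∀ n : ℕ, 1 ≤ n → fSeq a d n ≠ 0) :
    Submodule.span k (Set.range fun p : ℕ × ℕ × ℕ => y ^ p.1 * x ^ p.2.1 * z ^ p.2.2) = ⊤ := by
  have hsub : ∀ n, xFiltration k x y z n ≤ Submodule.span k
      (Set.range fun p : ℕ × ℕ × ℕ => y ^ p.1 * x ^ p.2.1 * z ^ p.2.2) := fun n => by
    refine Submodule.span_mono ?_
    rintro _ ⟨i, j, l, -, rfl⟩
    exact ⟨(i, j, l), rfl⟩
  have hmul : ∀ t : FreeAlgebra k (Fin 3), ∀ n, ∀ s ∈ xFiltration k x y z n,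
      ∃ m, π t * s ∈ xFiltration k x y z m := by
    intro t
    induction t using FreeAlgebra.induction with
    | grade0 r =>
      intro n s hs
      refine ⟨n, ?_⟩
      rw [AlgHom.commutes, ← Algebra.smul_def]
      exact Submodule.smul_mem _ _ hs
    | grade1 i =>
      intro n s hs
      refine ⟨n + 1, ?_⟩
      fin_cases i
      · change π (Xf k) * s ∈ _
        rw [hx]
        exact x_mul_mem_xFiltration hxy hs
      · change π (Yf k) * s ∈ _
        rw [hy]
        exact xFiltration_mono (Nat.le_succ n) (y_mul_mem_xFiltration hs)
      · change π (Zf k) * s ∈ _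
        rw [hz]
        exact z_mul_mem_xFiltration hxy hzx hzy hf hs
    | mul t u ht hu =>
      intro n s hs
      obtain ⟨m, hm⟩ := hu n s hs
      rw [map_mul, mul_assoc]
      exact ht m _ hm
    | add t u ht hu =>
      intro n s hs
      obtain ⟨m, hm⟩ := ht n s hs
      obtain ⟨m', hm'⟩ := hu n s hs
      refine ⟨max m m', ?_⟩
      rw [map_add, add_mul]
      exact add_mem (xFiltration_mono (le_max_left _ _) hm)
        (xFiltration_mono (le_max_right _ _) hm')
  refine eq_top_iff.2 fun t _ => ?_
  obtain ⟨t, rfl⟩ := hπ t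
  obtain ⟨m, hm⟩ := hmul t 0 1 (by
    simpa using (mem_xFiltration le_rfl : y ^ 0 * x ^ 0 * z ^ 0 ∈ xFiltration k x y z 0))
  exact hsub m (by simpa using hm)

end Spanning

section Representation

open Polynomial

/-- The inner variable of `K[y][x]`. -/
local notation "Y" => Polynomial.C Polynomial.X

variable {k : Type*} [Field k] {K : Type*} [CommRing K] [Algebra k K]

/-- The image of `y^i * x^j` under left multiplication by `z`, given the image `p` of `x^j`. -/
def zMonomial (B C E : k) (p : K[X][X]) (j : ℕ) : ℕ → K[X][X]
  | 0 => p
  | i + 1 => Y * (B • (X * (Y ^ i * X ^ j)) + C • (Y * (Y ^ i * X ^ j))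
      + E • zMonomial B C E p j i)

/-- Left multiplication by `z` on `K[y][x]`, given the images `p j` of the powers `x^j`. -/
def zOperator (B C E : k) (p : ℕ → K[X][X]) : K[X][X] →ₗ[K] K[X][X] :=
  Polynomial.lsum fun j => Polynomial.lsum fun i =>
    LinearMap.toSpanSingleton K K[X][X] (zMonomial B C E (p j) j i)

/-- The images of `1, x, …, x^n` under left multiplication by `z`, where `z` acts on `1` as the
scalar `ζ`. -/
def zPowersUpTo (a b c d e B C E : k) (ζ : K) : ℕ → ℕ → K[X][X]
  | 0 => fun _ => Polynomial.C (Polynomial.C ζ)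
  | n + 1 => Function.update (zPowersUpTo a b c d e B C E ζ n) (n + 1)
      ((1 - leadCoeff a d n)⁻¹ • (a • X ^ (n + 2) + b • (Y * X ^ (n + 1))
        + c • (Y * (Y * X ^ n)) + d • (X * zPowersUpTo a b c d e B C E ζ n n)
        + e • (Y * zPowersUpTo a b c d e B C E ζ n n)
        + zOperator B C E (zPowersUpTo a b c d e B C E ζ n)
            (zPowersUpTo a b c d e B C E ζ n n - leadCoeff a d n • X ^ (n + 1))))

/-- The image of `x^n` under left multiplication by `z`. -/
def zPower (a b c d e B C E : k) (ζ : K) (n : ℕ) : K[X][X] :=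
  zPowersUpTo a b c d e B C E ζ n n

lemma zOperator_monomial (B C E : k) (p : ℕ → K[X][X]) (i j : ℕ) :
    zOperator B C E p (Y ^ i * X ^ j) = zMonomial B C E (p j) j i := by
  rw [← map_pow, C_mul_X_pow_eq_monomial, X_pow_eq_monomial]
  simp [zOperator, Polynomial.lsum_apply]

lemma zOperator_X_pow (B C E : k) (p : ℕ → K[X][X]) (j : ℕ) :
    zOperator B C E p (X ^ j) = p j := by
  simpa [zMonomial] using zOperator_monomial B C E p 0 j

lemma mem_span_of_natDegree_le {n : ℕ} {t : K[X][X]} (ht : t.natDegree ≤ n) :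
    t ∈ Submodule.span K {s : K[X][X] | ∃ i j : ℕ, j ≤ n ∧ s = Y ^ i * X ^ j} := by
  rw [t.as_sum_range' (n + 1) (by omega)]
  refine Submodule.sum_mem _ fun j hj => ?_
  rw [(t.coeff j).as_sum_range, map_sum]
  refine Submodule.sum_mem _ fun i _ => ?_
  have : monomial j (monomial i ((t.coeff j).coeff i))
      = (t.coeff j).coeff i • (Y ^ i * X ^ j : K[X][X]) := by
    rw [← map_pow, C_mul_X_pow_eq_monomial, X_pow_eq_monomial, smul_monomial, smul_monomial,
      smul_eq_mul, mul_one]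
  rw [this]
  exact Submodule.smul_mem _ _ (Submodule.subset_span
    ⟨i, j, by simpa [Nat.lt_succ_iff] using hj, rfl⟩)

lemma linearMap_ext_monomial {M : Type*} [AddCommGroup M] [Module K M]
    {f g : K[X][X] →ₗ[K] M} (h : ∀ i j : ℕ, f (Y ^ i * X ^ j) = g (Y ^ i * X ^ j)) :
    f = g := by
  ext1 t
  refine (Submodule.span_le (p := LinearMap.eqLocus f g)).2 ?_ (mem_span_of_natDegree_le le_rfl)
  rintro _ ⟨i, j, -, rfl⟩
  exact h i j

lemma zOperator_congr (B C E : k) {p q : ℕ → K[X][X]} {n : ℕ} (h : ∀ j ≤ n, p j = q j)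
    {t : K[X][X]} (ht : t.natDegree ≤ n) : zOperator B C E p t = zOperator B C E q t := by
  have hle : Submodule.span K {s : K[X][X] | ∃ i j : ℕ, j ≤ n ∧ s = Y ^ i * X ^ j}
      ≤ LinearMap.eqLocus (zOperator B C E p) (zOperator B C E q) := by
    refine Submodule.span_le.2 ?_
    rintro _ ⟨i, j, hj, rfl⟩
    simp only [SetLike.mem_coe, LinearMap.mem_eqLocus, zOperator_monomial, h j hj]
  exact hle (mem_span_of_natDegree_le ht)

lemma natDegree_Y_mul_le (t : K[X][X]) : (Y * t).natDegree ≤ t.natDegree :=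
  natDegree_C_mul_le _ _

lemma natDegree_X_mul_le (t : K[X][X]) : (X * t).natDegree ≤ t.natDegree + 1 := by
  rw [add_comm]
  exact natDegree_mul_le_of_le natDegree_X_le le_rfl

lemma natDegree_smul_le_of_le (r : k) {t : K[X][X]} {n : ℕ} (h : t.natDegree ≤ n) :
    (r • t).natDegree ≤ n :=
  (natDegree_smul_le r t).trans h

lemma natDegree_monomial_le_right (i j : ℕ) : (Y ^ i * X ^ j : K[X][X]).natDegree ≤ j := by
  rw [← map_pow]
  exact natDegree_C_mul_X_pow_le _ _

lemma natDegree_zMonomial_le (B C E : k) {p : K[X][X]} {n j : ℕ} (hj : j ≤ n)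
    (hp : p.natDegree ≤ n + 1) (i : ℕ) : (zMonomial B C E p j i).natDegree ≤ n + 1 := by
  induction i with
  | zero => exact hp
  | succ i ih =>
    have hm := natDegree_monomial_le_right (K := K) i j
    refine (natDegree_Y_mul_le _).trans (natDegree_add_le_of_degree_le
      (natDegree_add_le_of_degree_le ?_ ?_) ?_) <;> refine natDegree_smul_le_of_le _ ?_
    · exact (natDegree_X_mul_le _).trans (by omega)
    · exact (natDegree_Y_mul_le _).trans (by omega)
    · exact ih

lemma natDegree_zOperator_le (B C E : k) {p : ℕ → K[X][X]} {n : ℕ}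
    (h : ∀ j ≤ n, (p j).natDegree ≤ n + 1) {t : K[X][X]} (ht : t.natDegree ≤ n) :
    (zOperator B C E p t).natDegree ≤ n + 1 := by
  have hspan := mem_span_of_natDegree_le ht
  clear ht
  induction hspan using Submodule.span_induction with
  | mem s hs =>
    obtain ⟨i, j, hj, rfl⟩ := hs
    rw [zOperator_monomial]
    exact natDegree_zMonomial_le B C E hj (h j hj) i
  | zero => simp
  | add s t _ _ hs ht =>
    rw [map_add]
    exact natDegree_add_le_of_degree_le hs ht
  | smul r s _ hs =>
    rw [map_smul]
    exact (natDegree_smul_le r _).trans hs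

lemma zPowersUpTo_of_le (a b c d e B C E : k) (ζ : K) {n j : ℕ} (h : j ≤ n) :
    zPowersUpTo a b c d e B C E ζ n j = zPower a b c d e B C E ζ j := by
  induction n, h using Nat.le_induction with
  | base => rfl
  | succ n hn ih =>
    rw [zPowersUpTo, Function.update_of_ne (by omega), ih]

lemma one_sub_smul_zPower_succ_of_natDegree_le {a b c d e B C E : k} {ζ : K}
    (hf : ∀ n : ℕ, 1 ≤ n → fSeq a d n ≠ 0) {n : ℕ}
    (h : (zPower a b c d e B C E ζ n - leadCoeff a d n • X ^ (n + 1)).natDegree ≤ n) :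
    (1 - leadCoeff a d n) • zPower a b c d e B C E ζ (n + 1)
      = a • X ^ (n + 2) + b • (Y * X ^ (n + 1)) + c • (Y * (Y * X ^ n))
        + d • (X * zPower a b c d e B C E ζ n) + e • (Y * zPower a b c d e B C E ζ n)
        + zOperator B C E (zPower a b c d e B C E ζ)
            (zPower a b c d e B C E ζ n - leadCoeff a d n • X ^ (n + 1)) := by
  rw [← zOperator_congr B C E
    (fun j hj => zPowersUpTo_of_le a b c d e B C E ζ hj : ∀ j ≤ n, _) h]
  conv_lhs => rw [zPower, zPowersUpTo, Function.update_self]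
  rw [smul_inv_smul₀ (one_sub_leadCoeff_ne_zero hf n)]
  rfl

lemma natDegree_zPower_sub_le {a b c d e B C E : k} {ζ : K}
    (hf : ∀ n : ℕ, 1 ≤ n → fSeq a d n ≠ 0) (n : ℕ) :
    (zPower a b c d e B C E ζ n - leadCoeff a d n • X ^ (n + 1)).natDegree ≤ n := by
  induction n using Nat.strong_induction_on with
  | _ n ih =>
  rcases n with _ | n
  · simp [zPower, zPowersUpTo, leadCoeff]
  have hX : ∀ m, (X ^ m : K[X][X]).natDegree ≤ m := natDegree_X_pow_le
  have hz : ∀ j ≤ n, (zPower a b c d e B C E ζ j).natDegree ≤ n + 1 := fun j hj => by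
    have h := natDegree_add_le_of_degree_le ((ih j (by omega)).trans (show j ≤ n + 1 by omega))
      (natDegree_smul_le_of_le (leadCoeff a d j) ((hX (j + 1)).trans (show j + 1 ≤ n + 1 by omega)))
    simpa using h
  have hn := ih n (by omega)
  have hrec := one_sub_smul_zPower_succ_of_natDegree_le hf hn
  have hαβ := leadCoeff_succ_mul hf n
  have hne := one_sub_leadCoeff_ne_zero hf n
  have hZ := natDegree_zOperator_le B C E hz hn
  set p := zPower a b c d e B C E ζ n with hp
  set α := leadCoeff a d n with hα
  set β := leadCoeff a d (n + 1) with hβ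
  set w := p - α • X ^ (n + 1) with hw
  have key : (1 - α) • (zPower a b c d e B C E ζ (n + 1) - β • X ^ (n + 1 + 1))
      = b • (Y * X ^ (n + 1)) + c • (Y * (Y * X ^ n)) + d • (X * w) + e • (Y * p)
        + zOperator B C E (zPower a b c d e B C E ζ) w := by
    have e3 : X * p = α • X ^ (n + 2) + X * w := by
      rw [hw, mul_sub, mul_smul_comm, ← pow_succ']
      abel
    rw [smul_sub, hrec, smul_smul, mul_comm (1 - α) β, hαβ, e3]
    module
  rw [← inv_smul_smul₀ hne (zPower a b c d e B C E ζ (n + 1) - β • X ^ (n + 1 + 1)), key]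
  refine natDegree_smul_le_of_le _ (natDegree_add_le_of_degree_le (natDegree_add_le_of_degree_le
    (natDegree_add_le_of_degree_le (natDegree_add_le_of_degree_le ?_ ?_) ?_) ?_) hZ) <;>
    refine natDegree_smul_le_of_le _ ?_
  · exact (natDegree_Y_mul_le _).trans (hX _)
  · exact (natDegree_Y_mul_le _).trans ((natDegree_Y_mul_le _).trans ((hX _).trans (by omega)))
  · exact (natDegree_X_mul_le _).trans (by omega)
  · exact (natDegree_Y_mul_le _).trans (hz n le_rfl)

lemma zOperator_mul_Y (B C E : k) (p : ℕ → K[X][X]) (t : K[X][X]) :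
    zOperator B C E p (Y * t)
      = Y * (B • (X * t) + C • (Y * t) + E • zOperator B C E p t) := by
  have h : zOperator B C E p ∘ₗ LinearMap.mulLeft K Y
      = LinearMap.mulLeft K Y ∘ₗ (B • LinearMap.mulLeft K X + C • LinearMap.mulLeft K Y
        + E • zOperator B C E p) := by
    refine linearMap_ext_monomial fun i j => ?_
    simp only [LinearMap.comp_apply, LinearMap.mulLeft_apply, LinearMap.add_apply,
      LinearMap.smul_apply, zOperator_monomial]
    rw [show Y * (Y ^ i * X ^ j : K[X][X]) = Y ^ (i + 1) * X ^ j by ring, zOperator_monomial,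
      zMonomial, show Y * (Y ^ i * X ^ j : K[X][X]) = Y ^ (i + 1) * X ^ j by ring]
  exact LinearMap.congr_fun h t

lemma zOperator_zPower_X_pow_succ {a b c d e B C E : k} {ζ : K}
    (hf : ∀ n : ℕ, 1 ≤ n → fSeq a d n ≠ 0) (n : ℕ) :
    zOperator B C E (zPower a b c d e B C E ζ) (X ^ (n + 1))
      = a • X ^ (n + 2) + b • (Y * X ^ (n + 1)) + c • (Y * (Y * X ^ n))
        + d • (X * zOperator B C E (zPower a b c d e B C E ζ) (X ^ n))
        + e • (Y * zOperator B C E (zPower a b c d e B C E ζ) (X ^ n))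
        + zOperator B C E (zPower a b c d e B C E ζ)
            (zOperator B C E (zPower a b c d e B C E ζ) (X ^ n)) := by
  have hrec := one_sub_smul_zPower_succ_of_natDegree_le hf
    (natDegree_zPower_sub_le (b := b) (c := c) (e := e) (B := B) (C := C) (E := E) (ζ := ζ) hf n)
  rw [map_sub, LinearMap.map_smul_of_tower, zOperator_X_pow, sub_smul, one_smul,
    sub_eq_iff_eq_add] at hrec
  rw [zOperator_X_pow, zOperator_X_pow, hrec]
  abel

/-- The defining relation `zx - (a·x² + b·xy + c·y² + d·xz + e·yz + z²)` commutes
with `y` up to the scalar `E²`. -/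
lemma relation_mul_y {A : Type*} [Ring A] [Algebra k A] {x y z : A} {a b c d e B C E : k}
    (h1 : E * (1 - B - E) = 0)
    (h2 : E * (-d - B + d * E) = 0)
    (h3 : B * (1 - d - B) - a * (1 - E ^ 2) = 0)
    (h4 : E * (C + C * E + e - e * E) = 0)
    (h5 : C * (1 - d - 2 * B - B * E) - b * (1 - E ^ 2) - e * B = 0)
    (h6 : (1 + E) * (-(c * (1 - E)) - C ^ 2) - e * C = 0)
    (hxy : x * y = y * x) (hzy : z * y = y * (B • x + C • y + E • z)) :
    (z * x - (a • x ^ 2 + b • (x * y) + c • y ^ 2 + d • (x * z) + e • (y * z) + z ^ 2)) * y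
      = E ^ 2 • (y * (z * x -
        (a • x ^ 2 + b • (x * y) + c • y ^ 2 + d • (x * z) + e • (y * z) + z ^ 2))) := by
  set w := B • x + C • y + E • z with hw
  have e1 : (z * x - (a • x ^ 2 + b • (x * y) + c • y ^ 2 + d • (x * z) + e • (y * z) + z ^ 2)) * y
      = y * (w * x - (a • x ^ 2 + b • (x * y) + c • y ^ 2 + d • (x * w) + e • (y * w) + w ^ 2)) := by
    have zxy : z * x * y = y * (w * x) := by rw [mul_assoc, hxy, ← mul_assoc, hzy, mul_assoc]
    have xxy : x ^ 2 * y = y * x ^ 2 := ((show Commute x y from hxy).pow_left 2).eq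
    have xyy : x * y * y = y * (x * y) := by rw [hxy, mul_assoc, hxy]
    have yyy : y ^ 2 * y = y * y ^ 2 := by rw [← pow_succ, ← pow_succ']
    have xzy : x * z * y = y * (x * w) := by rw [mul_assoc, hzy, ← mul_assoc, hxy, mul_assoc]
    have yzy : y * z * y = y * (y * w) := by rw [mul_assoc, hzy]
    have zzy : z ^ 2 * y = y * w ^ 2 := by
      rw [pow_two, mul_assoc, hzy, ← mul_assoc, hzy, mul_assoc, pow_two]
    simp only [sub_mul, add_mul, smul_mul_assoc, zxy, xxy, xyy, yyy, xzy, yzy, zzy, mul_sub,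
      mul_add, mul_smul_comm]
  have hzy' : z * y = B • (y * x) + C • (y * y) + E • (y * z) := by
    rw [hzy, hw]
    simp only [mul_add, mul_smul_comm]
  suffices h : w * x
      - (a • x ^ 2 + b • (x * y) + c • y ^ 2 + d • (x * w) + e • (y * w) + w ^ 2)
      = E ^ 2 • (z * x -
        (a • x ^ 2 + b • (x * y) + c • y ^ 2 + d • (x * z) + e • (y * z) + z ^ 2)) by
    rw [e1, h, mul_smul_comm]
  rw [hw]
  simp only [pow_two, mul_add, add_mul, smul_mul_assoc, mul_smul_comm, hxy, hzy']
  match_scalars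
  · linear_combination h3
  · linear_combination h5
  · linear_combination h1
  · linear_combination h6
  · linear_combination h2
  · linear_combination -h4
  · ring

lemma zOperator_zPower_mul_X {a b c d e B C E : k} {ζ : K}
    (h1 : E * (1 - B - E) = 0)
    (h2 : E * (-d - B + d * E) = 0)
    (h3 : B * (1 - d - B) - a * (1 - E ^ 2) = 0)
    (h4 : E * (C + C * E + e - e * E) = 0)
    (h5 : C * (1 - d - 2 * B - B * E) - b * (1 - E ^ 2) - e * B = 0)
    (h6 : (1 + E) * (-(c * (1 - E)) - C ^ 2) - e * C = 0)
    (hf : ∀ n : ℕ, 1 ≤ n → fSeq a d n ≠ 0)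
    {x y z : Module.End K K[X][X]} (hx : x = LinearMap.mulLeft K X)
    (hy : y = LinearMap.mulLeft K Y)
    (hz : z = zOperator B C E (zPower a b c d e B C E ζ)) :
    z * x = a • x ^ 2 + b • (x * y) + c • y ^ 2 + d • (x * z) + e • (y * z) + z ^ 2 := by
  have hxy : x * y = y * x := by
    subst hx hy
    refine LinearMap.ext fun t => ?_
    simp only [Module.End.mul_apply, LinearMap.mulLeft_apply]
    ring
  have hzy : z * y = y * (B • x + C • y + E • z) := by
    subst hx hy hz
    refine LinearMap.ext fun t => ?_
    simp only [Module.End.mul_apply, LinearMap.mulLeft_apply, LinearMap.add_apply,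
      LinearMap.smul_apply, zOperator_mul_Y]
  have hr := relation_mul_y (A := Module.End K K[X][X]) h1 h2 h3 h4 h5 h6 hxy hzy
  rw [← sub_eq_zero]
  set r := z * x - (a • x ^ 2 + b • (x * y) + c • y ^ 2 + d • (x * z) + e • (y * z) + z ^ 2)
    with hrdef
  refine linearMap_ext_monomial fun i j => ?_
  rw [LinearMap.zero_apply]
  induction i with
  | zero =>
    rw [pow_zero, one_mul, hrdef, LinearMap.sub_apply, sub_eq_zero]
    subst hx hy hz
    simp only [pow_two, Module.End.mul_apply, LinearMap.mulLeft_apply, LinearMap.add_apply,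
      LinearMap.smul_apply, ← pow_succ', zOperator_zPower_X_pow_succ hf j]
    simp only [pow_succ', ← mul_assoc, mul_comm (X : K[X][X]) Y]
  | succ i ih =>
    have : Y ^ (i + 1) * X ^ j = y (Y ^ i * X ^ j) := by
      rw [hy, LinearMap.mulLeft_apply, pow_succ', mul_assoc]
    rw [this, ← Module.End.mul_apply, hr, LinearMap.smul_apply, Module.End.mul_apply, ih,
      map_zero, smul_zero]

lemma linearIndependent_monomial (k : Type*) [Field k] :
    LinearIndependent k (fun p : ℕ × ℕ × ℕ =>
      (Y ^ p.1 * (X ^ p.2.1 * Polynomial.C (Polynomial.C (X ^ p.2.2))) : k[X][X][X])) := by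
  refine (linearIndependent_iff' (R := k) (M := k[X][X][X])).2 ?_
  intro s g hg p hp
  have h := congrArg (fun t : k[X][X][X] => ((t.coeff p.2.1).coeff p.1).coeff p.2.2) hg
  have hmon : ∀ q : ℕ × ℕ × ℕ,
      (Y ^ q.1 * (X ^ q.2.1 * Polynomial.C (Polynomial.C (X ^ q.2.2))) : k[X][X][X])
        = monomial q.2.1 (monomial q.1 (monomial q.2.2 1)) := fun q => by
    rw [← X_pow_eq_monomial, ← C_mul_X_pow_eq_monomial, ← C_mul_X_pow_eq_monomial, map_mul,
      map_pow Polynomial.C X q.1]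
    ring
  simp only [hmon, finsetSum_coeff, coeff_smul, coeff_monomial, coeff_zero] at h
  rw [Finset.sum_eq_single p] at h
  · simpa using h
  · rintro ⟨i, j, l⟩ _ hne
    obtain ⟨i', j', l'⟩ := p
    by_cases hj : j = j' <;> by_cases hi : i = i' <;> by_cases hl : l = l' <;>
      simp_all [coeff_monomial]
  · exact fun h => absurd hp h

end Representation

section Quotient

variable {k : Type*} [Field k] {a b c d e f A B C D E F : k}

lemma Tx_mul_Ty : Tx k a b c d e f A B C D E F * Ty k a b c d e f A B C D E F
    = Ty k a b c d e f A B C D E F * Tx k a b c d e f A B C D E F := by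
  simpa [Tx, Ty] using RingQuot.mkAlgHom_rel k
    (show Trel k a b c d e f A B C D E F _ _ from Or.inl ⟨rfl, rfl⟩)

lemma Tz_mul_Tx : Tz k a b c d e 1 0 B C 0 E 0 * Tx k a b c d e 1 0 B C 0 E 0
    = a • Tx k a b c d e 1 0 B C 0 E 0 ^ 2
      + b • (Tx k a b c d e 1 0 B C 0 E 0 * Ty k a b c d e 1 0 B C 0 E 0)
      + c • Ty k a b c d e 1 0 B C 0 E 0 ^ 2
      + d • (Tx k a b c d e 1 0 B C 0 E 0 * Tz k a b c d e 1 0 B C 0 E 0)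
      + e • (Ty k a b c d e 1 0 B C 0 E 0 * Tz k a b c d e 1 0 B C 0 E 0)
      + Tz k a b c d e 1 0 B C 0 E 0 ^ 2 := by
  simpa [Tx, Ty, Tz] using RingQuot.mkAlgHom_rel k
    (show Trel k a b c d e 1 0 B C 0 E 0 _ _ from Or.inr (Or.inl ⟨rfl, rfl⟩))

lemma Tz_mul_Ty : Tz k a b c d e 1 0 B C 0 E 0 * Ty k a b c d e 1 0 B C 0 E 0
    = B • (Tx k a b c d e 1 0 B C 0 E 0 * Ty k a b c d e 1 0 B C 0 E 0)
      + C • Ty k a b c d e 1 0 B C 0 E 0 ^ 2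
      + E • (Ty k a b c d e 1 0 B C 0 E 0 * Tz k a b c d e 1 0 B C 0 E 0) := by
  simpa [Tx, Ty, Tz] using RingQuot.mkAlgHom_rel k
    (show Trel k a b c d e 1 0 B C 0 E 0 _ _ from Or.inr (Or.inr ⟨rfl, rfl⟩))

lemma span_monomials_eq_top (hf : ∀ n : ℕ, 1 ≤ n → fSeq a d n ≠ 0) :
    Submodule.span k
      (Set.range fun p : ℕ × ℕ × ℕ =>
        (Ty k a b c d e 1 0 B C 0 E 0) ^ p.1 * (Tx k a b c d e 1 0 B C 0 E 0) ^ p.2.1 *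
          (Tz k a b c d e 1 0 B C 0 E 0) ^ p.2.2) = ⊤ :=
  span_monomials_eq_top_of_surjective (RingQuot.mkAlgHom_surjective k _) rfl rfl rfl
    Tx_mul_Ty Tz_mul_Tx Tz_mul_Ty hf

open Polynomial in
lemma linearIndependent_monomials
    (h1 : E * (1 - B - E) = 0)
    (h2 : E * (-d - B + d * E) = 0)
    (h3 : B * (1 - d - B) - a * (1 - E ^ 2) = 0)
    (h4 : E * (C + C * E + e - e * E) = 0)
    (h5 : C * (1 - d - 2 * B - B * E) - b * (1 - E ^ 2) - e * B = 0)
    (h6 : (1 + E) * (-(c * (1 - E)) - C ^ 2) - e * C = 0)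
    (hf : ∀ n : ℕ, 1 ≤ n → fSeq a d n ≠ 0) :
    LinearIndependent k
      (fun p : ℕ × ℕ × ℕ =>
        (Ty k a b c d e 1 0 B C 0 E 0) ^ p.1 * (Tx k a b c d e 1 0 B C 0 E 0) ^ p.2.1 *
          (Tz k a b c d e 1 0 B C 0 E 0) ^ p.2.2) := by
  let x : Module.End k[X] k[X][X][X] := LinearMap.mulLeft k[X] X
  let y : Module.End k[X] k[X][X][X] := LinearMap.mulLeft k[X] (Polynomial.C X)
  let z : Module.End k[X] k[X][X][X] := zOperator B C E (zPower a b c d e B C E X)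
  have hxy : x * y = y * x := by
    refine LinearMap.ext fun t => ?_
    simp only [x, y, Module.End.mul_apply, LinearMap.mulLeft_apply]
    ring
  have hzy : z * y = B • (x * y) + C • y ^ 2 + E • (y * z) := by
    refine LinearMap.ext fun t => ?_
    simp only [x, y, z, pow_two, Module.End.mul_apply, LinearMap.mulLeft_apply,
      LinearMap.add_apply, LinearMap.smul_apply, zOperator_mul_Y, mul_add, mul_smul_comm]
    rw [mul_left_comm]
  have hzx : z * x = a • x ^ 2 + b • (x * y) + c • y ^ 2 + d • (x * z) + e • (y * z) + z ^ 2 :=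
    zOperator_zPower_mul_X h1 h2 h3 h4 h5 h6 hf rfl rfl rfl
  let φ : FreeAlgebra k (Fin 3) →ₐ[k] Module.End k[X] k[X][X][X] := FreeAlgebra.lift k ![x, y, z]
  have hφx : φ (Xf k) = x := by simp [φ, Xf]
  have hφy : φ (Yf k) = y := by simp [φ, Yf]
  have hφz : φ (Zf k) = z := by simp [φ, Zf]
  have hφ : ∀ ⦃m n⦄, Trel k a b c d e 1 0 B C 0 E 0 m n → φ m = φ n := by
    rintro m n (⟨rfl, rfl⟩ | ⟨rfl, rfl⟩ | ⟨rfl, rfl⟩)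
    · simpa [hφx, hφy] using hxy
    · simpa [hφx, hφy, hφz] using hzx
    · simpa [hφx, hφy, hφz] using hzy
  let ψ : Talg k a b c d e 1 0 B C 0 E 0 →ₐ[k] Module.End k[X] k[X][X][X] :=
    RingQuot.liftAlgHom k ⟨φ, hφ⟩
  have hψx : ψ (Tx k a b c d e 1 0 B C 0 E 0) = x := by simp [ψ, Tx, hφx]
  have hψy : ψ (Ty k a b c d e 1 0 B C 0 E 0) = y := by simp [ψ, Ty, hφy]
  have hψz : ψ (Tz k a b c d e 1 0 B C 0 E 0) = z := by simp [ψ, Tz, hφz]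
  let ev : Talg k a b c d e 1 0 B C 0 E 0 →ₗ[k] k[X][X][X] :=
    { toFun := fun t => ψ t 1
      map_add' := fun s t => by simp
      map_smul' := fun r t => by simp }
  refine LinearIndependent.of_comp ev ?_
  convert linearIndependent_monomial k using 1
  funext p
  have hz1 : z 1 = (X : k[X]) • 1 := by
    have := zOperator_X_pow B C E (zPower a b c d e B C E (X : k[X])) 0
    rw [pow_zero] at this
    rw [show z 1 = _ from this, zPower, zPowersUpTo, Algebra.smul_def, mul_one,
      Polynomial.algebraMap_apply, Polynomial.algebraMap_apply, Algebra.algebraMap_self_apply]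
  have hzl : ∀ l, (z ^ l) 1 = (X ^ l : k[X]) • 1 := by
    intro l
    induction l with
    | zero => simp
    | succ l ih => rw [pow_succ', Module.End.mul_apply, ih, map_smul, hz1, smul_smul, pow_succ]
  have hxl : ∀ l t, (x ^ l) t = X ^ l * t := fun l t => by
    simp only [x, LinearMap.pow_mulLeft, LinearMap.mulLeft_apply]
  have hyl : ∀ l t, (y ^ l) t = Polynomial.C X ^ l * t := fun l t => by
    simp only [y, LinearMap.pow_mulLeft, LinearMap.mulLeft_apply]
  simp only [Function.comp_apply, ev, LinearMap.coe_mk, AddHom.coe_mk, map_mul, map_pow, hψx,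
    hψy, hψz, Module.End.mul_apply, hzl, hxl, hyl]
  rw [Algebra.smul_def, mul_one, Polynomial.algebraMap_apply, Polynomial.algebraMap_apply,
    Algebra.algebraMap_self_apply, map_pow, map_pow]

end Quotient

/-- If the parameters satisfy the six equations obtained by setting `G₂ = 0`, and
`f_n(a,d) ≠ 0` for all `n ≥ 1`, then the family `(i,j,l) ↦ y^i x^j z^l` is a `k`-basis of
`T = T(a,b,c,d,e,1; 0,B,C,0,E,0)`. -/
theorem stmt13 {k : Type*} [Field k] [IsAlgClosed k] (a b c d e B C E : k)
    (h1 : E * (1 - B - E) = 0)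
    (h2 : E * (-d - B + d * E) = 0)
    (h3 : B * (1 - d - B) - a * (1 - E ^ 2) = 0)
    (h4 : E * (C + C * E + e - e * E) = 0)
    (h5 : C * (1 - d - 2 * B - B * E) - b * (1 - E ^ 2) - e * B = 0)
    (h6 : (1 + E) * (-(c * (1 - E)) - C ^ 2) - e * C = 0)
    (hf : ∀ n : ℕ, 1 ≤ n → fSeq a d n ≠ 0) :
    ThasBasis k a b c d e 1 0 B C 0 E 0 := by
  exact ⟨linearIndependent_monomials h1 h2 h3 h4 h5 h6 hf, span_monomials_eq_top hf⟩
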